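/- arXiv:2409.17739 — 2 statements merged into one kernel-verified Lean document; each statement's English description precedes it below -/
import Mathlib

section
/- Let f ∈ L¹(X,μ)⁺ on a σ-finite measure space. Then the Lorenz curve satisfies the variational formula: for every t > 0, ∫₀ᵗ f↓(s) ds equals the supremum of ∫_X e·f dμ over all measurable e with 0 ≤ e ≤ 1 and ∫_X e dμ ≤ t. -/
open MeasureTheory Set
open scoped ENNReal

/-- The distribution function `D_f(t) = μ{x : f x > t}`. -/
noncomputable def distFun {X : Type*} [MeasurableSpace X] (μ : Measure X)
    (f : X → ℝ≥0∞) (t : ℝ≥0∞) : ℝ≥0∞ := μ {x | t < f x}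

/-- The decreasing rearrangement `f↓(r) = inf {t > 0 : D_f(t) ≤ r}`. -/
noncomputable def decRearr {X : Type*} [MeasurableSpace X] (μ : Measure X)
    (f : X → ℝ≥0∞) (r : ℝ) : ℝ≥0∞ :=
  sInf {t : ℝ≥0∞ | 0 < t ∧ distFun μ f t ≤ ENNReal.ofReal r}

lemma vol_aux (t : ℝ) (c : ℝ≥0∞) :
    volume ({s : ℝ | ENNReal.ofReal s < c} ∩ Ioc 0 t) = min c (ENNReal.ofReal t) := by
  rcases lt_or_ge (ENNReal.ofReal t) c with h | h
  · have : {s : ℝ | ENNReal.ofReal s < c} ∩ Ioc 0 t = Ioc 0 t := by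
      apply inter_eq_right.2
      intro s hs
      exact (ENNReal.ofReal_le_ofReal hs.2).trans_lt h
    rw [this, min_eq_right h.le, Real.volume_Ioc, sub_zero]
  · have hc : c ≠ ∞ := (h.trans_lt ENNReal.ofReal_lt_top).ne
    have : {s : ℝ | ENNReal.ofReal s < c} ∩ Ioc 0 t = Ioo 0 c.toReal := by
      ext s
      simp only [mem_inter_iff, mem_setOf_eq, mem_Ioc, mem_Ioo]
      constructor
      · rintro ⟨h1, h2, h3⟩
        exact ⟨h2, (ENNReal.ofReal_lt_iff_lt_toReal h2.le hc).1 h1⟩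
      · rintro ⟨h1, h2⟩
        have h3 := (ENNReal.ofReal_lt_iff_lt_toReal h1.le hc).2 h2
        refine ⟨h3, h1, ?_⟩
        by_contra h4
        push Not at h4
        exact absurd (h3.trans_le h) (not_lt.2 (ENNReal.ofReal_le_ofReal h4.le))
    rw [this, min_eq_left h, Real.volume_Ioo, sub_zero, ENNReal.ofReal_toReal hc]

lemma vol_aux2 (c : ℝ≥0∞) :
    volume ({s : ℝ | ENNReal.ofReal s < c} ∩ Ioi 0) = c := by
  by_cases hc : c = ∞
  · subst hc
    simp
  · have : {s : ℝ | ENNReal.ofReal s < c} ∩ Ioi 0 = Ioo 0 c.toReal := by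
      ext s
      simp only [mem_inter_iff, mem_setOf_eq, mem_Ioi, mem_Ioo]
      constructor
      · rintro ⟨h1, h2⟩
        exact ⟨h2, (ENNReal.ofReal_lt_iff_lt_toReal h2.le hc).1 h1⟩
      · rintro ⟨h1, h2⟩
        exact ⟨(ENNReal.ofReal_lt_iff_lt_toReal h1.le hc).2 h2, h1⟩
    rw [this, Real.volume_Ioo, sub_zero, ENNReal.ofReal_toReal hc]

lemma layer_aux {Y : Type*} [MeasurableSpace Y] (ν : Measure Y) [SFinite ν]
    (g : Y → ℝ≥0∞) (hg : Measurable g) :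
    ∫⁻ y, g y ∂ν = ∫⁻ l in Ioi (0 : ℝ), ν {y | ENNReal.ofReal l < g y} := by
  have hm : MeasurableSet {p : Y × ℝ | ENNReal.ofReal p.2 < g p.1} :=
    measurableSet_lt (by fun_prop) (by fun_prop)
  have h1 := Measure.prod_apply (μ := ν) (ν := volume.restrict (Ioi (0 : ℝ))) hm
  have h2 := Measure.prod_apply_symm (μ := ν) (ν := volume.restrict (Ioi (0 : ℝ))) hm
  rw [h1] at h2
  rw [show (∫⁻ l in Ioi (0 : ℝ), ν {y | ENNReal.ofReal l < g y}) = _ from h2.symm]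
  refine lintegral_congr fun y => ?_
  have hs : MeasurableSet {s : ℝ | ENNReal.ofReal s < g y} :=
    measurableSet_lt (by fun_prop) (by fun_prop)
  exact ((Measure.restrict_apply hs).trans (vol_aux2 (g y))).symm

section
variable {X : Type*} [MeasurableSpace X] (μ : Measure X) (f : X → ℝ≥0∞)

lemma distFun_anti {a b : ℝ≥0∞} (h : a ≤ b) : distFun μ f b ≤ distFun μ f a :=
  measure_mono fun _ hx => lt_of_le_of_lt h hx

lemma lt_decRearr_iff (l : ℝ≥0∞) (r : ℝ) :
    l < decRearr μ f r ↔ ENNReal.ofReal r < distFun μ f l := by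
  constructor
  · intro h
    by_contra h2
    push Not at h2
    obtain ⟨b, hb1, hb2⟩ := exists_between h
    have hb0 : 0 < b := (zero_le).trans_lt hb1
    exact absurd hb2 (not_lt.2 (sInf_le ⟨hb0, (distFun_anti μ f hb1.le).trans h2⟩))
  · intro h
    have hl : l < ∞ := by
      by_contra h2
      rw [not_lt, top_le_iff] at h2
      subst h2
      simp [distFun] at h
    obtain ⟨u, hu1, hu2, hu3⟩ := exists_seq_strictAnti_tendsto' hl
    have hU : {x | l < f x} = ⋃ n, {x | u n < f x} := by
      ext x
      simp only [mem_setOf_eq, mem_iUnion]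
      constructor
      · intro hx
        exact ((hu3.eventually (gt_mem_nhds hx)).exists)
      · rintro ⟨n, hn⟩
        exact (hu2 n).1.trans hn
    have hmono : Monotone fun n => {x | u n < f x} := fun a b hab x hx =>
      lt_of_le_of_lt (hu1.antitone hab) hx
    rw [distFun, hU, hmono.measure_iUnion, lt_iSup_iff] at h
    obtain ⟨n, hn⟩ := h
    refine (hu2 n).1.trans_le (le_sInf ?_)
    rintro b ⟨_, hb⟩
    by_contra h3
    push Not at h3
    exact absurd (hn.trans_le ((distFun_anti μ f h3.le).trans hb)) (lt_irrefl _)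

lemma decRearr_anti : Antitone (decRearr μ f) := by
  intro a b hab
  refine le_of_forall_lt fun l hl => ?_
  rw [lt_decRearr_iff] at hl ⊢
  exact (ENNReal.ofReal_le_ofReal hab).trans_lt hl

lemma lorenz_eq (t : ℝ) :
    ∫⁻ s in Ioc (0 : ℝ) t, decRearr μ f s =
      ∫⁻ l in Ioi (0 : ℝ), min (distFun μ f (ENNReal.ofReal l)) (ENNReal.ofReal t) := by
  have hm : Measurable (decRearr μ f) := (decRearr_anti μ f).measurable
  rw [layer_aux _ _ hm]
  refine lintegral_congr fun l => ?_
  rw [Measure.restrict_apply (measurableSet_lt measurable_const hm), ← vol_aux]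
  simp only [lt_decRearr_iff]

lemma markov_aux (hf : Measurable f) (hint : ∫⁻ x, f x ∂μ ≠ ∞) {a : ℝ≥0∞} (ha : 0 < a) :
    μ {x | a ≤ f x} < ∞ := by
  have h := mul_meas_ge_le_lintegral (μ := μ) hf a
  by_contra h2
  rw [not_lt, top_le_iff] at h2
  rw [h2, ENNReal.mul_top ha.ne', top_le_iff] at h
  exact hint h

lemma le_meas_ge (hf : Measurable f) (hint : ∫⁻ x, f x ∂μ ≠ ∞) (t : ℝ)
    (h0 : 0 < decRearr μ f t) :
    ENNReal.ofReal t ≤ μ {x | decRearr μ f t ≤ f x} := by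
  obtain ⟨u, hu1, hu2, hu3⟩ := exists_seq_strictMono_tendsto' h0
  have hI : {x | decRearr μ f t ≤ f x} = ⋂ n, {x | u n < f x} := by
    ext x
    simp only [mem_setOf_eq, mem_iInter]
    constructor
    · intro hx n
      exact (hu2 n).2.trans_le hx
    · intro h
      exact le_of_tendsto' hu3 fun n => (h n).le
  have hanti : Antitone fun n => {x | u n < f x} := fun a b hab x hx =>
    lt_of_le_of_lt (hu1.monotone hab) hx
  rw [hI, hanti.measure_iInter (fun n => (measurableSet_lt measurable_const hf).nullMeasurableSet)
    ⟨0, ((measure_mono fun x (hx : u 0 < f x) => hx.le).trans_lt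
      (markov_aux μ f hf hint (hu2 0).1)).ne⟩]
  exact le_iInf fun n => ((lt_decRearr_iff μ f _ _).1 (hu2 n).2).le

end

/-- Variational formula for the Lorenz curve: for `f ∈ L¹(X,μ)⁺` and `t > 0`,
`∫₀ᵗ f↓(s) ds` equals the supremum of `∫ e·f dμ` over measurable `e` with
`0 ≤ e ≤ 1` and `∫ e dμ ≤ t`. -/
theorem stmt1 {X : Type*} [MeasurableSpace X] (μ : Measure X) [SigmaFinite μ]
    (f : X → ℝ≥0∞) (hf : Measurable f) (hint : ∫⁻ x, f x ∂μ ≠ ∞)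
    (t : ℝ) (ht : 0 < t) :
    ∫⁻ s in Set.Ioc (0 : ℝ) t, decRearr μ f s =
      sSup {c : ℝ≥0∞ | ∃ e : X → ℝ≥0∞, Measurable e ∧ (∀ x, e x ≤ 1) ∧
        (∫⁻ x, e x ∂μ) ≤ ENNReal.ofReal t ∧ c = ∫⁻ x, e x * f x ∂μ} := by
  rw [lorenz_eq]
  have key : ∀ e : X → ℝ≥0∞, Measurable e → ∫⁻ x, e x * f x ∂μ =
      ∫⁻ l in Ioi (0 : ℝ), ∫⁻ x in {x | ENNReal.ofReal l < f x}, e x ∂μ := by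
    intro e he
    have h1 := lintegral_withDensity_eq_lintegral_mul μ he hf
    simp only [Pi.mul_apply] at h1
    rw [← h1, layer_aux _ _ hf]
    refine lintegral_congr fun l => ?_
    rw [withDensity_apply _ (measurableSet_lt measurable_const hf)]
  apply le_antisymm
  · apply le_sSup
    set a := decRearr μ f t with ha
    have hDa : distFun μ f a ≤ ENNReal.ofReal t := by
      by_contra h
      push Not at h
      exact lt_irrefl _ ((lt_decRearr_iff μ f _ _).2 h)
    have hmE : MeasurableSet {x | f x = a} := hf (measurableSet_singleton a)
    have hmG : MeasurableSet {x | a < f x} := measurableSet_lt measurable_const hf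
    have hdisj : Disjoint {x | a < f x} {x | f x = a} := by
      rw [Set.disjoint_left]
      intro x hx hx2
      exact (ne_of_gt hx) hx2
    obtain ⟨θ, hθ1, hθ2, hθ3⟩ : ∃ θ : ℝ≥0∞, θ ≤ 1 ∧
        distFun μ f a + θ * μ {x | f x = a} ≤ ENNReal.ofReal t ∧
        (0 < a → distFun μ f a + θ * μ {x | f x = a} = ENNReal.ofReal t) := by
      rcases eq_or_ne a 0 with h0 | h0
      · exact ⟨0, zero_le, by simpa using hDa, fun h => absurd h0 h.ne'⟩
      · have hpos : 0 < a := pos_iff_ne_zero.2 h0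
        have hsplit : {x | a ≤ f x} = {x | a < f x} ∪ {x | f x = a} := by
          ext x
          simp only [mem_setOf_eq, mem_union]
          rw [le_iff_lt_or_eq, eq_comm (a := a)]
        have h1 := le_meas_ge μ f hf hint t hpos
        rw [← ha, hsplit, measure_union hdisj hmE] at h1
        have hE : μ {x | f x = a} ≠ ∞ :=
          ((measure_mono fun x (hx : f x = a) => hx.ge).trans_lt
            (markov_aux μ f hf hint hpos)).ne
        have h2 : ENNReal.ofReal t - distFun μ f a ≤ μ {x | f x = a} :=
          tsub_le_iff_left.2 h1
        have h3 : (ENNReal.ofReal t - distFun μ f a) / μ {x | f x = a} * μ {x | f x = a}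
            = ENNReal.ofReal t - distFun μ f a := by
          refine ENNReal.div_mul_cancel' (fun h => ?_) (fun h => absurd h hE)
          rw [h] at h2
          exact le_antisymm h2 zero_le
        have h4 : distFun μ f a + (ENNReal.ofReal t - distFun μ f a) / μ {x | f x = a} *
            μ {x | f x = a} = ENNReal.ofReal t := by
          rw [h3, add_tsub_cancel_of_le hDa]
        exact ⟨_, ENNReal.div_le_of_le_mul (by simpa using h2), h4.le, fun _ => h4⟩
    set e : X → ℝ≥0∞ := fun x =>
      {x | a < f x}.indicator (fun _ => 1) x + {x | f x = a}.indicator (fun _ => θ) x with he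
    have hem : Measurable e :=
      (measurable_const.indicator hmG).add (measurable_const.indicator hmE)
    have hset : ∀ ν : Measure X, ∫⁻ x, e x ∂ν = ν {x | a < f x} + θ * ν {x | f x = a} := by
      intro ν
      rw [he, lintegral_add_left (measurable_const.indicator hmG),
        lintegral_indicator_const hmG, lintegral_indicator_const hmE, one_mul]
    refine ⟨e, hem, ?_, ?_, ?_⟩
    · intro x
      by_cases h1 : a < f x
      · have h2 : ¬ f x = a := h1.ne'
        simp [he, h1, h2]
      · by_cases h2 : f x = a
        · simp [he, h2, hθ1]
        · simp [he, h1, h2]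
    · rw [hset]
      exact hθ2
    · rw [key e hem]
      refine lintegral_congr fun l => ?_
      rw [hset, Measure.restrict_apply hmG, Measure.restrict_apply hmE]
      rcases lt_or_ge (ENNReal.ofReal l) a with hl | hl
      · have i1 : {x | a < f x} ∩ {x | ENNReal.ofReal l < f x} = {x | a < f x} :=
          inter_eq_left.2 fun x hx => hl.trans hx
        have i2 : {x | f x = a} ∩ {x | ENNReal.ofReal l < f x} = {x | f x = a} :=
          inter_eq_left.2 fun x (hx : f x = a) => by
            change ENNReal.ofReal l < f x
            rwa [hx]
        rw [i1, i2, min_eq_right ((lt_decRearr_iff μ f _ _).1 hl).le]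
        exact (hθ3 (zero_le.trans_lt hl)).symm
      · have i1 : {x | a < f x} ∩ {x | ENNReal.ofReal l < f x} = {x | ENNReal.ofReal l < f x} :=
          inter_eq_right.2 fun x hx => lt_of_le_of_lt hl hx
        have i2 : {x | f x = a} ∩ {x | ENNReal.ofReal l < f x} = ∅ := by
          ext x
          simp only [mem_inter_iff, mem_setOf_eq, mem_empty_iff_false, iff_false, not_and, not_lt]
          intro hx
          rwa [hx]
        rw [i1, i2, measure_empty, mul_zero, add_zero,
          min_eq_left ((distFun_anti μ f hl).trans hDa)]
        rfl
  · apply sSup_le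
    rintro c ⟨e, hem, he1, het, rfl⟩
    rw [key e hem]
    refine lintegral_mono fun l => le_min ?_ ?_
    · calc _ ≤ ∫⁻ x in {x | ENNReal.ofReal l < f x}, 1 ∂μ := lintegral_mono he1
        _ = _ := by simp [distFun]
    · exact (setLIntegral_le_lintegral _ _).trans het
end

section
/- Let T be a doubly substochastic operator from (X,μ) to (Y,ν) that is integral-preserving on functions supported in a measurable set Ω ⊆ X. Then T agrees on functions supported in Ω with some doubly stochastic operator from (X,μ) to (Y,ν) if and only if μ(X∖Ω) = ∫_Y (1 − T(χ_Ω)) dν, where both sides may be infinite. -/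
open MeasureTheory Set
open scoped ENNReal

/-- A doubly substochastic operator from `(X,μ)` to `(Y,ν)`, bundled together with its
dual doubly substochastic operator. -/
structure DSSPair {X Y : Type*} [MeasurableSpace X] [MeasurableSpace Y]
    (μ : Measure X) (ν : Measure Y) where
  T : Lp ℝ ⊤ μ →ₗ[ℝ] Lp ℝ ⊤ ν
  T' : Lp ℝ ⊤ ν →ₗ[ℝ] Lp ℝ ⊤ μ
  posT : ∀ h : Lp ℝ ⊤ μ, (∀ᵐ x ∂μ, 0 ≤ h x) → ∀ᵐ y ∂ν, 0 ≤ (T h) y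
  posT' : ∀ g : Lp ℝ ⊤ ν, (∀ᵐ y ∂ν, 0 ≤ g y) → ∀ᵐ x ∂μ, 0 ≤ (T' g) x
  subT : ∀ h : Lp ℝ ⊤ μ, (∀ᵐ x ∂μ, h x ≤ 1) → ∀ᵐ y ∂ν, (T h) y ≤ 1
  subT' : ∀ g : Lp ℝ ⊤ ν, (∀ᵐ y ∂ν, g y ≤ 1) → ∀ᵐ x ∂μ, (T' g) x ≤ 1
  subintT : ∀ h : Lp ℝ ⊤ μ, (∀ᵐ x ∂μ, 0 ≤ h x) →
    ∫⁻ y, ENNReal.ofReal ((T h) y) ∂ν ≤ ∫⁻ x, ENNReal.ofReal (h x) ∂μ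
  subintT' : ∀ g : Lp ℝ ⊤ ν, (∀ᵐ y ∂ν, 0 ≤ g y) →
    ∫⁻ x, ENNReal.ofReal ((T' g) x) ∂μ ≤ ∫⁻ y, ENNReal.ofReal (g y) ∂ν
  duality : ∀ (h : Lp ℝ ⊤ μ) (g : Lp ℝ ⊤ ν),
    (∀ᵐ x ∂μ, 0 ≤ h x) → (∀ᵐ y ∂ν, 0 ≤ g y) →
    ∫⁻ y, ENNReal.ofReal ((T h) y * g y) ∂ν
      = ∫⁻ x, ENNReal.ofReal (h x * (T' g) x) ∂μ

/-- A doubly substochastic pair is doubly stochastic if it is unital and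
integral-preserving on nonnegative integrable functions. -/
def DSSPair.IsDS {X Y : Type*} [MeasurableSpace X] [MeasurableSpace Y]
    {μ : Measure X} {ν : Measure Y} (D : DSSPair μ ν) : Prop :=
  (∀ h : Lp ℝ ⊤ μ, (⇑h =ᵐ[μ] fun _ => (1 : ℝ)) → ⇑(D.T h) =ᵐ[ν] fun _ => (1 : ℝ)) ∧
  (∀ h : Lp ℝ ⊤ μ, (∀ᵐ x ∂μ, 0 ≤ h x) → Integrable h μ →
    ∫⁻ y, ENNReal.ofReal ((D.T h) y) ∂ν = ∫⁻ x, ENNReal.ofReal (h x) ∂μ)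

namespace StmtSeven

lemma exists_lin {X Y : Type*} [MeasurableSpace X] [MeasurableSpace Y]
    {μ : Measure X} {ν : Measure Y} (Φ : Lp ℝ ⊤ μ → Y → ℝ)
    (hm : ∀ h, MemLp (Φ h) ⊤ ν)
    (hadd : ∀ h k, Φ (h + k) =ᵐ[ν] fun y => Φ h y + Φ k y)
    (hsmul : ∀ (c : ℝ) h, Φ (c • h) =ᵐ[ν] fun y => c * Φ h y) :
    ∃ R : Lp ℝ ⊤ μ →ₗ[ℝ] Lp ℝ ⊤ ν, ∀ h, ⇑(R h) =ᵐ[ν] Φ h := by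
  refine ⟨{ toFun := fun h => (hm h).toLp (Φ h), map_add' := ?_, map_smul' := ?_ }, ?_⟩
  · intro h k
    apply Lp.ext
    filter_upwards [(hm (h + k)).coeFn_toLp, (hm h).coeFn_toLp, (hm k).coeFn_toLp, hadd h k,
      Lp.coeFn_add ((hm h).toLp (Φ h)) ((hm k).toLp (Φ k))] with y h1 h2 h3 h4 h5
    rw [h1, h5, h4, Pi.add_apply, h2, h3]
  · intro c h
    apply Lp.ext
    filter_upwards [(hm (c • h)).coeFn_toLp, (hm h).coeFn_toLp, hsmul c h,
      Lp.coeFn_smul c ((hm h).toLp (Φ h))] with y h1 h2 h3 h4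
    rw [h1, h3, RingHom.id_apply, h4, Pi.smul_apply, h2, smul_eq_mul]
  · intro h
    exact (hm h).coeFn_toLp

lemma ae_bound {X : Type*} [MeasurableSpace X] {μ : Measure X} (h : Lp ℝ ⊤ μ) :
    ∀ᵐ x ∂μ, |h x| ≤ ‖h‖ := by
  filter_upwards [ae_le_eLpNormEssSup (f := ⇑h) (μ := μ)] with x hx
  rw [← eLpNorm_exponent_top] at hx
  rw [Lp.norm_def, ← Real.norm_eq_abs, ← toReal_enorm]
  exact ENNReal.toReal_mono (Lp.eLpNorm_ne_top h) hx

lemma exists_indicator {X : Type*} [MeasurableSpace X] (μ : Measure X) (Ω : Set X)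
    (hΩ : MeasurableSet Ω) :
    ∃ P : Lp ℝ ⊤ μ →ₗ[ℝ] Lp ℝ ⊤ μ, ∀ h, ⇑(P h) =ᵐ[μ] Ω.indicator h := by
  apply exists_lin
  · intro h
    exact (Lp.memLp h).indicator hΩ
  · intro h k
    filter_upwards [Lp.coeFn_add h k] with x hx
    by_cases hx' : x ∈ Ω
    · simp only [indicator_of_mem hx', hx, Pi.add_apply]
    · simp [hx']
  · intro c h
    filter_upwards [Lp.coeFn_smul c h] with x hx
    by_cases hx' : x ∈ Ω
    · simp only [indicator_of_mem hx', hx, Pi.smul_apply, smul_eq_mul]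
    · simp [hx']

lemma exists_kernel {X Y : Type*} [MeasurableSpace X] [MeasurableSpace Y]
    (μ : Measure X) (ν : Measure Y) [SigmaFinite μ] [SigmaFinite ν]
    (K : X → Y → ℝ≥0∞) (hK : Measurable (Function.uncurry K))
    (hK1 : ∀ᵐ y ∂ν, ∫⁻ x, K x y ∂μ ≤ 1) :
    ∃ R : Lp ℝ ⊤ μ →ₗ[ℝ] Lp ℝ ⊤ ν,
      (∀ h, ∀ᵐ y ∂ν, R h y = ∫ x, (K x y).toReal * h x ∂μ) ∧
      (∀ h, (∀ᵐ x ∂μ, 0 ≤ h x) → ∀ᵐ y ∂ν, 0 ≤ R h y ∧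
        ENNReal.ofReal (R h y) = ∫⁻ x, K x y * ENNReal.ofReal (h x) ∂μ) := by
  have hKy : ∀ y, Measurable fun x => K x y := fun y => hK.comp (measurable_prodMk_right)
  have hint : ∀ᵐ y ∂ν, Integrable (fun x => (K x y).toReal) μ := by
    filter_upwards [hK1] with y hy
    exact integrable_toReal_of_lintegral_ne_top (hKy y).aemeasurable
      (hy.trans_lt ENNReal.one_lt_top).ne
  have hint2 : ∀ h : Lp ℝ ⊤ μ, ∀ᵐ y ∂ν, Integrable (fun x => (K x y).toReal * h x) μ := by
    intro h
    filter_upwards [hint] with y hy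
    exact hy.mul_bdd (c := ‖h‖) (Lp.aestronglyMeasurable h) (ae_bound h)
  obtain ⟨R, hR⟩ := exists_lin (μ := μ) (ν := ν)
    (fun h y => ∫ x, (K x y).toReal * h x ∂μ) (by
      intro h
      refine memLp_top_of_bound ?_ ‖h‖ ?_
      · have : StronglyMeasurable (fun p : Y × X => (K p.2 p.1).toReal * h p.2) := by
          apply Measurable.stronglyMeasurable
          apply Measurable.mul
          · exact (hK.comp measurable_swap).ennreal_toReal
          · exact (Lp.stronglyMeasurable h).measurable.comp measurable_snd
        exact this.integral_prod_right'.aestronglyMeasurable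
      · filter_upwards [hK1, hint, hint2 h] with y h1 h2 h3
        calc ‖∫ x, (K x y).toReal * h x ∂μ‖ ≤ ∫ x, ‖(K x y).toReal * h x‖ ∂μ :=
              norm_integral_le_integral_norm _
          _ ≤ ∫ x, (K x y).toReal * ‖h‖ ∂μ := by
              apply integral_mono_ae h3.norm (h2.mul_const _)
              filter_upwards [ae_bound h] with x hx
              simp only [norm_mul, Real.norm_eq_abs, abs_of_nonneg ENNReal.toReal_nonneg]
              exact mul_le_mul_of_nonneg_left hx ENNReal.toReal_nonneg
          _ = (∫ x, (K x y).toReal ∂μ) * ‖h‖ := integral_mul_const _ _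
          _ ≤ 1 * ‖h‖ := by
              gcongr
              rw [integral_toReal (hKy y).aemeasurable
                (ae_lt_top (hKy y) (h1.trans_lt ENNReal.one_lt_top).ne)]
              exact ENNReal.toReal_le_of_le_ofReal zero_le_one (by simpa using h1)
          _ = ‖h‖ := one_mul _)
    (by
      intro h k
      filter_upwards [hint2 h, hint2 k] with y h1 h2
      rw [← integral_add h1 h2]
      apply integral_congr_ae
      filter_upwards [Lp.coeFn_add h k] with x hx
      simp only [hx, Pi.add_apply]
      ring)
    (by
      intro c h
      refine Filter.Eventually.of_forall fun y => ?_
      simp only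
      rw [← integral_const_mul]
      apply integral_congr_ae
      filter_upwards [Lp.coeFn_smul c h] with x hx
      simp only [hx, Pi.smul_apply, smul_eq_mul]
      ring)
  refine ⟨R, hR, ?_⟩
  intro h hh
  filter_upwards [hR h, hint2 h, hK1] with y h1 h2 h3
  have hnn : 0 ≤ᵐ[μ] fun x => (K x y).toReal * h x := by
    filter_upwards [hh] with x hx
    exact mul_nonneg ENNReal.toReal_nonneg hx
  rw [h1]
  refine ⟨integral_nonneg_of_ae hnn, ?_⟩
  rw [ofReal_integral_eq_lintegral_ofReal h2 hnn]
  apply lintegral_congr_ae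
  filter_upwards [ae_lt_top (hKy y) (h3.trans_lt ENNReal.one_lt_top).ne] with x hx
  rw [ENNReal.ofReal_mul ENNReal.toReal_nonneg, ENNReal.ofReal_toReal hx.ne]

/-- total interval -/
lemma union_Ico {X : Type*} [MeasurableSpace X] (μ : Measure X) [SigmaFinite μ] :
    (⋃ n, Ico (0 : ℝ) (μ (spanningSets μ n)).toReal) =
      {t | 0 ≤ t ∧ ENNReal.ofReal t < μ univ} := by
  have hsup : μ univ = ⨆ n, μ (spanningSets μ n) := by
    rw [← iUnion_spanningSets μ, (monotone_spanningSets μ).measure_iUnion]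
  ext t
  simp only [mem_iUnion, mem_Ico, mem_ofPred_eq, hsup, lt_iSup_iff]
  constructor
  · rintro ⟨n, h0, hn⟩
    exact ⟨h0, n, (ENNReal.ofReal_lt_iff_lt_toReal h0 (measure_spanningSets_lt_top μ n).ne).2 hn⟩
  · rintro ⟨h0, n, hn⟩
    exact ⟨n, h0, (ENNReal.ofReal_lt_iff_lt_toReal h0 (measure_spanningSets_lt_top μ n).ne).1 hn⟩

/-- The intervals attached to a sigma-finite measure. -/
noncomputable def Iv {X : Type*} [MeasurableSpace X] (μ : Measure X) [SigmaFinite μ] :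
    ℕ → Set ℝ := disjointed (fun n => Ico (0 : ℝ) (μ (spanningSets μ n)).toReal)

lemma Iv_meas {X : Type*} [MeasurableSpace X] (μ : Measure X) [SigmaFinite μ] (n : ℕ) :
    MeasurableSet (Iv μ n) := MeasurableSet.disjointed (fun _ => measurableSet_Ico) n

lemma Iv_volume {X : Type*} [MeasurableSpace X] (μ : Measure X) [SigmaFinite μ] (n : ℕ) :
    volume (Iv μ n) = μ (spanningSetsIndex μ ⁻¹' {n}) := by
  rw [preimage_spanningSetsIndex_singleton, Iv]
  have hfin := fun n => (measure_spanningSets_lt_top μ n).ne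
  cases n with
  | zero => simp [disjointed_zero, hfin]
  | succ n =>
    have hmono : Monotone (fun n => Ico (0 : ℝ) (μ (spanningSets μ n)).toReal) := by
      intro a b hab
      exact Ico_subset_Ico_right (ENNReal.toReal_mono (hfin b)
        (measure_mono (monotone_spanningSets μ hab)))
    have hsub : Ico (0 : ℝ) (μ (spanningSets μ n)).toReal ⊆
        Ico (0 : ℝ) (μ (spanningSets μ (n + 1))).toReal := hmono (Nat.le_succ n)
    rw [hmono.disjointed_add_one, (monotone_spanningSets μ).disjointed_add_one,
      measure_sdiff hsub measurableSet_Ico.nullMeasurableSet (by simp),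
      measure_sdiff (monotone_spanningSets μ (Nat.le_add_right n 1))
        (measurableSet_spanningSets μ n).nullMeasurableSet (hfin n)]
    simp [hfin]

/-- The coupling density between two cells. -/
noncomputable def cK {X Y : Type*} [MeasurableSpace X] [MeasurableSpace Y]
    (μ : Measure X) (ν : Measure Y) [SigmaFinite μ] [SigmaFinite ν] (n m : ℕ) : ℝ≥0∞ :=
  volume (Iv μ n ∩ Iv ν m) / (volume (Iv μ n) * volume (Iv ν m))

lemma coupling_half {X Y : Type*} [MeasurableSpace X] [MeasurableSpace Y]
    (μ : Measure X) (ν : Measure Y) [SigmaFinite μ] [SigmaFinite ν]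
    (huv : μ univ = ν univ) :
    ∀ᵐ y ∂ν, ∫⁻ x, cK μ ν (spanningSetsIndex μ x) (spanningSetsIndex ν y) ∂μ = 1 := by
  have hfinμ : ∀ n, volume (Iv μ n) ≠ ⊤ := by
    intro n
    refine ((measure_mono (disjointed_subset _ n)).trans_lt ?_).ne
    simp
  have hfinν : ∀ n, volume (Iv ν n) ≠ ⊤ := by
    intro n
    refine ((measure_mono (disjointed_subset _ n)).trans_lt ?_).ne
    simp
  have hnz : ∀ᵐ y ∂ν, volume (Iv ν (spanningSetsIndex ν y)) ≠ 0 := by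
    have : ∀ n, ∀ᵐ y ∂ν, spanningSetsIndex ν y = n → volume (Iv ν n) ≠ 0 := by
      intro n
      by_cases h0 : volume (Iv ν n) = 0
      · rw [Iv_volume] at h0
        have := measure_eq_zero_iff_ae_notMem.1 h0
        filter_upwards [this] with y hy hn
        exact absurd hn hy
      · exact Filter.Eventually.of_forall fun _ _ => h0
    filter_upwards [ae_all_iff.2 this] with y hy
    exact hy _ rfl
  filter_upwards [hnz] with y hy
  set m := spanningSetsIndex ν y
  let F : ℕ → ℝ≥0∞ := fun n => cK μ ν n m
  change ∫⁻ x, F (spanningSetsIndex μ x) ∂μ = 1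
  rw [← lintegral_map (f := F) (measurable_of_countable _) (measurableSet_spanningSetsIndex μ),
    lintegral_countable']
  have hterm : ∀ n, F n * (μ.map (spanningSetsIndex μ)) {n} =
      volume (Iv μ n ∩ Iv ν m) * (volume (Iv ν m))⁻¹ := by
    intro n
    rw [Measure.map_apply (measurableSet_spanningSetsIndex μ) (measurableSet_singleton n),
      ← Iv_volume]
    by_cases h0 : volume (Iv μ n) = 0
    · have : volume (Iv μ n ∩ Iv ν m) = 0 := measure_mono_null inter_subset_left h0
      simp [h0, this]
    · simp only [F, cK]
      rw [ENNReal.div_eq_inv_mul, ENNReal.mul_inv (Or.inl h0) (Or.inl (hfinμ n))]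
      calc _ = ((volume (Iv μ n))⁻¹ * volume (Iv μ n)) *
            (volume (Iv μ n ∩ Iv ν m) * (volume (Iv ν m))⁻¹) := by ring
        _ = _ := by rw [ENNReal.inv_mul_cancel h0 (hfinμ n), one_mul]
  simp_rw [hterm]
  rw [ENNReal.tsum_mul_right, ← measure_iUnion, ← iUnion_inter]
  · have hsub : Iv ν m ⊆ ⋃ n, Iv μ n := by
      have h1 : (⋃ n, Iv μ n) = ⋃ n, Iv ν n := by
        rw [Iv, iUnion_disjointed, Iv, iUnion_disjointed, union_Ico, union_Ico, huv]
      rw [h1]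
      exact subset_iUnion (Iv ν) m
    rw [inter_eq_right.2 hsub, ENNReal.mul_inv_cancel hy (hfinν m)]
  · intro i j hij
    exact ((disjoint_disjointed _) hij).mono inter_subset_left inter_subset_left
  · intro n
    exact (Iv_meas μ n).inter (Iv_meas ν m)

lemma exists_coupling {X Y : Type*} [MeasurableSpace X] [MeasurableSpace Y]
    (μ : Measure X) (ν : Measure Y) [SigmaFinite μ] [SigmaFinite ν]
    (huv : μ univ = ν univ) :
    ∃ q : X → Y → ℝ≥0∞, Measurable (Function.uncurry q) ∧
      (∀ᵐ y ∂ν, ∫⁻ x, q x y ∂μ = 1) ∧ (∀ᵐ x ∂μ, ∫⁻ y, q x y ∂ν = 1) := by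
  refine ⟨fun x y => cK μ ν (spanningSetsIndex μ x) (spanningSetsIndex ν y), ?_,
      coupling_half μ ν huv, ?_⟩
  · have h1 : Measurable fun p : ℕ × ℕ => cK μ ν p.1 p.2 := measurable_of_countable _
    have h2 : Measurable fun p : X × Y => spanningSetsIndex μ p.1 :=
      (measurableSet_spanningSetsIndex μ).comp measurable_fst
    have h3 : Measurable fun p : X × Y => spanningSetsIndex ν p.2 :=
      (measurableSet_spanningSetsIndex ν).comp measurable_snd
    have h4 : Measurable fun p : X × Y => (spanningSetsIndex μ p.1, spanningSetsIndex ν p.2) :=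
      h2.prodMk h3
    have h5 := h1.comp h4
    rw [Function.comp_def] at h5
    rw [Function.uncurry_def]
    exact h5
  · filter_upwards [coupling_half ν μ huv.symm] with x hx
    rw [← hx]
    apply lintegral_congr
    intro y
    rw [cK, cK, inter_comm, mul_comm]

lemma exists_K {X Y : Type*} [MeasurableSpace X] [MeasurableSpace Y]
    (μ : Measure X) (ν : Measure Y) [SigmaFinite μ] [SigmaFinite ν]
    (Ω : Set X) (hΩ : MeasurableSet Ω) (g : Y → ℝ) (hg : Measurable g)
    (hm : μ Ωᶜ = ∫⁻ y, ENNReal.ofReal (g y) ∂ν) :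
    ∃ K : X → Y → ℝ≥0∞, Measurable (Function.uncurry K) ∧
      (∀ x y, x ∈ Ω → K x y = 0) ∧
      (∀ᵐ y ∂ν, ∫⁻ x, K x y ∂μ = ENNReal.ofReal (g y)) ∧
      (∀ᵐ x ∂μ, ∫⁻ y, K x y ∂ν = Ωᶜ.indicator (fun _ => 1) x) := by
  obtain ⟨q, hq, h1, h2⟩ := exists_coupling (μ.restrict Ωᶜ)
    (ν.withDensity fun y => ENNReal.ofReal (g y)) (by simpa using hm)
  refine ⟨fun x y => Ωᶜ.indicator (fun _ => 1) x * (q x y * ENNReal.ofReal (g y)), ?_, ?_, ?_, ?_⟩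
  · apply Measurable.mul
    · exact (measurable_const.indicator hΩ.compl).comp measurable_fst
    · exact hq.mul (hg.ennreal_ofReal.comp measurable_snd)
  · intro x y hx
    simp [hx]
  · rw [ae_withDensity_iff hg.ennreal_ofReal] at h1
    filter_upwards [h1] with y hy
    by_cases h0 : ENNReal.ofReal (g y) = 0
    · simp [h0]
    · have hqy : Measurable fun x => q x y := hq.comp measurable_prodMk_right
      have : ∀ x, Ωᶜ.indicator (fun _ => (1 : ℝ≥0∞)) x * (q x y * ENNReal.ofReal (g y)) =
          Ωᶜ.indicator (fun x => q x y * ENNReal.ofReal (g y)) x := by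
        intro x
        by_cases hx : x ∈ Ω <;> simp [hx]
      simp_rw [this]
      rw [lintegral_indicator hΩ.compl, lintegral_mul_const _ hqy, hy h0, one_mul]
  · rw [ae_restrict_iff' hΩ.compl] at h2
    filter_upwards [h2] with x hx
    have hqx : Measurable fun y => q x y := hq.comp measurable_prodMk_left
    rw [lintegral_const_mul (f := fun y => q x y * ENNReal.ofReal (g y)) _
      (hqx.mul hg.ennreal_ofReal)]
    by_cases hxΩ : x ∈ Ω
    · simp [hxΩ]
    · have := hx hxΩ
      rw [lintegral_withDensity_eq_lintegral_mul _ hg.ennreal_ofReal hqx] at this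
      simp only [Pi.mul_apply, mul_comm (ENNReal.ofReal _)] at this
      rw [this, mul_one]

end StmtSeven

namespace StmtSeven

lemma exists_one {X : Type*} [MeasurableSpace X] (μ : Measure X) :
    ∃ one : Lp ℝ ⊤ μ, ∀ᵐ x ∂μ, one x = 1 :=
  ⟨(memLp_top_const (1 : ℝ)).toLp _, (memLp_top_const (1 : ℝ)).coeFn_toLp⟩

lemma lintegral_ind {X : Type*} [MeasurableSpace X] (μ : Measure X) (B : Set X)
    (hB : MeasurableSet B) (f : X → ℝ) (hf : f =ᵐ[μ] B.indicator (fun _ => (1 : ℝ))) :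
    ∫⁻ x, ENNReal.ofReal (f x) ∂μ = μ B := by
  rw [← lintegral_indicator_one hB]
  apply lintegral_congr_ae
  filter_upwards [hf] with x hx
  rw [hx]
  by_cases h : x ∈ B <;> simp [h]

lemma forward {X Y : Type*} [MeasurableSpace X] [MeasurableSpace Y]
    (μ : Measure X) (ν : Measure Y) [SigmaFinite μ] [SigmaFinite ν]
    (D : DSSPair μ ν) (Ω : Set X) (hΩ : MeasurableSet Ω)
    (e : Lp ℝ ⊤ μ) (he : ⇑e =ᵐ[μ] Ω.indicator (fun _ => (1 : ℝ))) :
    (∃ D' : DSSPair μ ν, D'.IsDS ∧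
        ∀ h : Lp ℝ ⊤ μ, (∀ᵐ x ∂μ, x ∉ Ω → h x = 0) → D'.T h = D.T h) →
      μ Ωᶜ = ∫⁻ y, ENNReal.ofReal (1 - (D.T e) y) ∂ν := by
  rintro ⟨D', ⟨hD1, hD2⟩, hag⟩
  obtain ⟨one, hone⟩ := exists_one μ
  have hchi : ∀ B : Set X, MeasurableSet B →
      ∃ a : Lp ℝ ⊤ μ, ⇑a =ᵐ[μ] B.indicator (fun _ => (1 : ℝ)) := by
    intro B hB
    obtain ⟨P, hP⟩ := exists_indicator μ B hB
    refine ⟨P one, ?_⟩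
    filter_upwards [hP one, hone] with x h1 h2
    rw [h1]
    by_cases h : x ∈ B <;> simp [h, h2]
  obtain ⟨a, ha⟩ := hchi Ωᶜ hΩ.compl
  have hsum : a = one - e := by
    apply Lp.ext
    filter_upwards [ha, he, hone, Lp.coeFn_sub one e] with x h1 h2 h3 h4
    rw [h1, h4, Pi.sub_apply, h2, h3]
    by_cases h : x ∈ Ω <;> simp [h]
  have hTe : D'.T e = D.T e := by
    apply hag
    filter_upwards [he] with x hx hn
    simp [hx, hn]
  have hTa : ∀ᵐ y ∂ν, D'.T a y = 1 - D.T e y := by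
    rw [hsum, map_sub, hTe]
    filter_upwards [Lp.coeFn_sub (D'.T one) (D.T e), hD1 one hone] with y h1 h2
    rw [h1, Pi.sub_apply, h2]
  have hR : ∫⁻ y, ENNReal.ofReal (1 - (D.T e) y) ∂ν = ∫⁻ y, ENNReal.ofReal (D'.T a y) ∂ν := by
    apply lintegral_congr_ae
    filter_upwards [hTa] with y hy
    rw [hy]
  rw [hR]
  apply le_antisymm
  · rw [← Measure.iSup_restrict_spanningSets (μ := μ) Ωᶜ]
    refine iSup_le fun n => ?_
    rw [Measure.restrict_apply hΩ.compl]
    have hBm : MeasurableSet (Ωᶜ ∩ spanningSets μ n) :=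
      hΩ.compl.inter (measurableSet_spanningSets μ n)
    have hBf : μ (Ωᶜ ∩ spanningSets μ n) < ⊤ :=
      (measure_mono inter_subset_right).trans_lt (measure_spanningSets_lt_top μ n)
    obtain ⟨b, hb⟩ := hchi _ hBm
    have hb0 : ∀ᵐ x ∂μ, 0 ≤ b x := by
      filter_upwards [hb] with x hx
      rw [hx]
      exact indicator_nonneg (fun _ _ => zero_le_one) x
    have hbi : Integrable b μ := by
      rw [integrable_congr hb, integrable_indicator_iff hBm]
      exact integrableOn_const hBf.ne
    rw [← lintegral_ind μ _ hBm b hb, ← hD2 b hb0 hbi]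
    apply lintegral_mono_ae
    have hpos := D'.posT (a - b) (by
      filter_upwards [ha, hb, Lp.coeFn_sub a b] with x h1 h2 h3
      rw [h3, Pi.sub_apply, h1, h2, sub_nonneg]
      exact indicator_le_indicator_of_subset inter_subset_left (fun _ => zero_le_one) x)
    rw [map_sub] at hpos
    filter_upwards [hpos, Lp.coeFn_sub (D'.T a) (D'.T b)] with y h1 h2
    rw [h2, Pi.sub_apply, sub_nonneg] at h1
    exact ENNReal.ofReal_le_ofReal h1
  · rw [← lintegral_ind μ _ hΩ.compl a ha]
    apply D'.subintT
    filter_upwards [ha] with x hx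
    rw [hx]
    exact indicator_nonneg (fun _ _ => zero_le_one) x

lemma backward {X Y : Type*} [MeasurableSpace X] [MeasurableSpace Y]
    (μ : Measure X) (ν : Measure Y) [SigmaFinite μ] [SigmaFinite ν]
    (D : DSSPair μ ν) (Ω : Set X) (hΩ : MeasurableSet Ω)
    (hIP : ∀ h : Lp ℝ ⊤ μ, (∀ᵐ x ∂μ, 0 ≤ h x) → Integrable h μ →
      (∀ᵐ x ∂μ, x ∉ Ω → h x = 0) →
      ∫⁻ y, ENNReal.ofReal ((D.T h) y) ∂ν = ∫⁻ x, ENNReal.ofReal (h x) ∂μ)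
    (e : Lp ℝ ⊤ μ) (he : ⇑e =ᵐ[μ] Ω.indicator (fun _ => (1 : ℝ)))
    (hm : μ Ωᶜ = ∫⁻ y, ENNReal.ofReal (1 - (D.T e) y) ∂ν) :
    ∃ D' : DSSPair μ ν, D'.IsDS ∧
        ∀ h : Lp ℝ ⊤ μ, (∀ᵐ x ∂μ, x ∉ Ω → h x = 0) → D'.T h = D.T h := by
  obtain ⟨one, hone⟩ := exists_one μ
  obtain ⟨one', hone'⟩ := exists_one ν
  obtain ⟨P, hP⟩ := exists_indicator μ Ω hΩ
  have hPone : P one = e := by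
    apply Lp.ext
    filter_upwards [hP one, he, hone] with x h1 h2 h3
    rw [h1, h2]
    by_cases h : x ∈ Ω <;> simp [h, h3]
  have hPpos : ∀ h : Lp ℝ ⊤ μ, (∀ᵐ x ∂μ, 0 ≤ h x) → ∀ᵐ x ∂μ, 0 ≤ P h x := by
    intro h hh
    filter_upwards [hP h, hh] with x h1 h2
    rw [h1]
    by_cases h : x ∈ Ω <;> simp [h, h2]
  have hmeas : ∀ h : Lp ℝ ⊤ μ, Measurable h := fun h => (Lp.stronglyMeasurable h).measurable
  have hmeas' : ∀ h : Lp ℝ ⊤ ν, Measurable h := fun h => (Lp.stronglyMeasurable h).measurable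
  have he0 : ∀ᵐ x ∂μ, 0 ≤ e x := by
    filter_upwards [he] with x hx
    rw [hx]
    exact indicator_nonneg (fun _ _ => zero_le_one) x
  have he1 : ∀ᵐ x ∂μ, e x ≤ 1 := by
    filter_upwards [he] with x hx
    rw [hx]
    exact indicator_le_self' (fun _ _ => zero_le_one) x
  have hTe0 := D.posT e he0
  have hTe1 := D.subT e he1
  obtain ⟨K, hK, hKΩ, hKx, hKy⟩ := exists_K μ ν Ω hΩ (fun y => 1 - D.T e y)
    (measurable_const.sub (hmeas' _)) hm
  have hKswap : Measurable (Function.uncurry fun y x => K x y) := hK.comp measurable_swap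
  have hK1 : ∀ᵐ y ∂ν, ∫⁻ x, K x y ∂μ ≤ 1 := by
    filter_upwards [hKx, hTe0] with y h1 h2
    rw [h1]
    exact ENNReal.ofReal_le_one.2 (by linarith)
  have hK1' : ∀ᵐ x ∂μ, ∫⁻ y, K x y ∂ν ≤ 1 := by
    filter_upwards [hKy] with x h1
    rw [h1]
    exact indicator_le_self' (fun _ _ => zero_le_one) x
  obtain ⟨R, hR, hRn⟩ := exists_kernel μ ν K hK hK1
  obtain ⟨R', hR', hRn'⟩ := exists_kernel ν μ (fun y x => K x y) hKswap hK1'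
  have hKym : ∀ y, Measurable fun x => K x y := fun y => hK.comp measurable_prodMk_right
  have hKxm : ∀ x, Measurable fun y => K x y := fun x => hK.comp measurable_prodMk_left
  -- Tonelli
  have hton : ∀ (f : X → ℝ≥0∞) (k : Y → ℝ≥0∞), Measurable f → Measurable k →
      ∫⁻ y, (∫⁻ x, K x y * f x ∂μ) * k y ∂ν = ∫⁻ x, f x * (∫⁻ y, K x y * k y ∂ν) ∂μ := by
    intro f k hf hk
    have h1 : ∀ y, (∫⁻ x, K x y * f x ∂μ) * k y = ∫⁻ x, K x y * f x * k y ∂μ := fun y =>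
      (lintegral_mul_const _ ((hKym y).mul hf)).symm
    have h2 : ∀ x, f x * (∫⁻ y, K x y * k y ∂ν) = ∫⁻ y, K x y * f x * k y ∂ν := fun x => by
      rw [← lintegral_const_mul (f := fun y => K x y * k y) _ ((hKxm x).mul hk)]
      apply lintegral_congr
      intro y
      ring
    simp_rw [h1, h2]
    apply lintegral_lintegral_swap
    exact ((hKswap.mul (hf.comp measurable_snd)).mul (hk.comp measurable_fst)).aemeasurable
  have hRone : ∀ᵐ y ∂ν, R one y = 1 - D.T e y := by
    have h0 : ∀ᵐ x ∂μ, 0 ≤ one x := by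
      filter_upwards [hone] with x hx
      rw [hx]
      exact zero_le_one
    filter_upwards [hRn one h0, hKx, hTe1] with y h1 h2 h3
    have h4 : ∫⁻ x, K x y * ENNReal.ofReal (one x) ∂μ = ∫⁻ x, K x y ∂μ := by
      apply lintegral_congr_ae
      filter_upwards [hone] with x hx
      simp [hx]
    have h5 := h1.2
    rw [h4, h2] at h5
    exact (ENNReal.ofReal_eq_ofReal_iff h1.1 (by linarith)).1 h5
  have hRone' : ∀ᵐ x ∂μ, R' one' x = Ωᶜ.indicator (fun _ => (1 : ℝ)) x := by
    have h0 : ∀ᵐ x ∂ν, 0 ≤ one' x := by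
      filter_upwards [hone'] with x hx
      rw [hx]
      exact zero_le_one
    filter_upwards [hRn' one' h0, hKy] with x h1 h2
    have h4 : ∫⁻ y, K x y * ENNReal.ofReal (one' y) ∂ν = ∫⁻ y, K x y ∂ν := by
      apply lintegral_congr_ae
      filter_upwards [hone'] with x hx
      simp [hx]
    have h5 := h1.2
    rw [h4, h2] at h5
    have h6 : Ωᶜ.indicator (fun _ => (1 : ℝ≥0∞)) x =
        ENNReal.ofReal (Ωᶜ.indicator (fun _ => (1 : ℝ)) x) := by
      by_cases h : x ∈ Ω <;> simp [h]
    rw [h6] at h5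
    exact (ENNReal.ofReal_eq_ofReal_iff h1.1
      (indicator_nonneg (fun _ _ => zero_le_one) x)).1 h5
  -- the operators
  let S : Lp ℝ ⊤ μ →ₗ[ℝ] Lp ℝ ⊤ ν := D.T ∘ₗ P + R
  let S' : Lp ℝ ⊤ ν →ₗ[ℝ] Lp ℝ ⊤ μ := P ∘ₗ D.T' + R'
  have hS : ∀ h, ∀ᵐ y ∂ν, S h y = D.T (P h) y + R h y := fun h =>
    Lp.coeFn_add (D.T (P h)) (R h)
  have hS' : ∀ k, ∀ᵐ x ∂μ, S' k x = P (D.T' k) x + R' k x := fun k =>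
    Lp.coeFn_add (P (D.T' k)) (R' k)
  have hSone : ∀ᵐ y ∂ν, S one y = 1 := by
    filter_upwards [hS one, hRone] with y h1 h2
    rw [h1, h2, hPone]
    ring
  have hSone' : ∀ᵐ x ∂μ, S' one' x ≤ 1 := by
    have h0 := D.subT' one' (by filter_upwards [hone'] with y hy using hy.le)
    filter_upwards [hS' one', hRone', hP (D.T' one'), h0] with x h1 h2 h3 h4
    rw [h1, h2, h3]
    by_cases h : x ∈ Ω <;> simp [h, h4]
  have hSpos : ∀ h : Lp ℝ ⊤ μ, (∀ᵐ x ∂μ, 0 ≤ h x) → ∀ᵐ y ∂ν, 0 ≤ S h y := by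
    intro h hh
    filter_upwards [hS h, D.posT _ (hPpos h hh), hRn h hh] with y h1 h2 h3
    rw [h1]
    exact add_nonneg h2 h3.1
  have hSpos' : ∀ k : Lp ℝ ⊤ ν, (∀ᵐ y ∂ν, 0 ≤ k y) → ∀ᵐ x ∂μ, 0 ≤ S' k x := by
    intro k hk
    filter_upwards [hS' k, hPpos _ (D.posT' k hk), hRn' k hk] with y h1 h2 h3
    rw [h1]
    exact add_nonneg h2 h3.1
  have hSsub : ∀ h : Lp ℝ ⊤ μ, (∀ᵐ x ∂μ, h x ≤ 1) → ∀ᵐ y ∂ν, S h y ≤ 1 := by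
    intro h hh
    have h0 := hSpos (one - h) (by
      filter_upwards [Lp.coeFn_sub one h, hone, hh] with x h1 h2 h3
      rw [h1, Pi.sub_apply, h2]
      linarith)
    rw [map_sub] at h0
    filter_upwards [h0, Lp.coeFn_sub (S one) (S h), hSone] with y h1 h2 h3
    rw [h2, Pi.sub_apply, h3] at h1
    linarith
  have hSsub' : ∀ k : Lp ℝ ⊤ ν, (∀ᵐ y ∂ν, k y ≤ 1) → ∀ᵐ x ∂μ, S' k x ≤ 1 := by
    intro k hk
    have h0 := hSpos' (one' - k) (by
      filter_upwards [Lp.coeFn_sub one' k, hone', hk] with x h1 h2 h3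
      rw [h1, Pi.sub_apply, h2]
      linarith)
    rw [map_sub] at h0
    filter_upwards [h0, Lp.coeFn_sub (S' one') (S' k), hSone'] with y h1 h2 h3
    rw [h2, Pi.sub_apply] at h1
    linarith
  have hdual : ∀ (h : Lp ℝ ⊤ μ) (k : Lp ℝ ⊤ ν),
      (∀ᵐ x ∂μ, 0 ≤ h x) → (∀ᵐ y ∂ν, 0 ≤ k y) →
      ∫⁻ y, ENNReal.ofReal (S h y * k y) ∂ν = ∫⁻ x, ENNReal.ofReal (h x * S' k x) ∂μ := by
    intro h k hh hk
    have hL : ∫⁻ y, ENNReal.ofReal (S h y * k y) ∂ν =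
        ∫⁻ y, ENNReal.ofReal (D.T (P h) y * k y) ∂ν +
        ∫⁻ y, (∫⁻ x, K x y * ENNReal.ofReal (h x) ∂μ) * ENNReal.ofReal (k y) ∂ν := by
      rw [← lintegral_add_left (f := fun y => ENNReal.ofReal (D.T (P h) y * k y))
        ((hmeas' _).mul (hmeas' k)).ennreal_ofReal]
      apply lintegral_congr_ae
      filter_upwards [hS h, hRn h hh, hk, D.posT _ (hPpos h hh)] with y h1 h2 h3 h4
      rw [h1, add_mul, ENNReal.ofReal_add (mul_nonneg h4 h3) (mul_nonneg h2.1 h3),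
        ENNReal.ofReal_mul h2.1, h2.2]
    have hRt : ∫⁻ x, ENNReal.ofReal (h x * S' k x) ∂μ =
        ∫⁻ x, ENNReal.ofReal (P h x * D.T' k x) ∂μ +
        ∫⁻ x, ENNReal.ofReal (h x) * (∫⁻ y, K x y * ENNReal.ofReal (k y) ∂ν) ∂μ := by
      rw [← lintegral_add_left (f := fun x => ENNReal.ofReal (P h x * D.T' k x))
        ((hmeas _).mul (hmeas _)).ennreal_ofReal]
      apply lintegral_congr_ae
      filter_upwards [hS' k, hRn' k hk, hh, D.posT' k hk, hP h, hP (D.T' k), hPpos h hh]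
        with x h1 h2 h3 h4 h5 h6 h7
      have h8 : h x * P (D.T' k) x = P h x * D.T' k x := by
        rw [h5, h6]
        by_cases hx : x ∈ Ω <;> simp [hx]
      rw [h1, mul_add, h8, ENNReal.ofReal_add (mul_nonneg h7 h4) (mul_nonneg h3 h2.1),
        ENNReal.ofReal_mul h3, h2.2]
    rw [hL, hRt, D.duality (P h) k (hPpos h hh) hk,
      hton _ _ (hmeas h).ennreal_ofReal (hmeas' k).ennreal_ofReal]
  have hSint : ∀ h : Lp ℝ ⊤ μ, (∀ᵐ x ∂μ, 0 ≤ h x) →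
      ∫⁻ y, ENNReal.ofReal (S h y) ∂ν = ∫⁻ y, ENNReal.ofReal (D.T (P h) y) ∂ν +
        ∫⁻ x, ENNReal.ofReal (h x) * Ωᶜ.indicator (fun _ => 1) x ∂μ := by
    intro h hh
    have h1 : ∫⁻ x, ENNReal.ofReal (h x) * Ωᶜ.indicator (fun _ => 1) x ∂μ =
        ∫⁻ y, ENNReal.ofReal (R h y) ∂ν := by
      have h2 := hton _ (fun _ => 1) (hmeas h).ennreal_ofReal measurable_const
      simp only [mul_one] at h2
      have h3 : ∫⁻ y, ENNReal.ofReal (R h y) ∂ν =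
          ∫⁻ y, (∫⁻ x, K x y * ENNReal.ofReal (h x) ∂μ) ∂ν := by
        apply lintegral_congr_ae
        filter_upwards [hRn h hh] with y hy using hy.2
      rw [h3, h2]
      apply lintegral_congr_ae
      filter_upwards [hKy] with x hx
      rw [hx]
    rw [h1, ← lintegral_add_left (hmeas' _).ennreal_ofReal]
    apply lintegral_congr_ae
    filter_upwards [hS h, hRn h hh, D.posT _ (hPpos h hh)] with y h1 h2 h3
    rw [h1, ENNReal.ofReal_add h3 h2.1]
  have hsplit : ∀ h : Lp ℝ ⊤ μ, ∫⁻ x, ENNReal.ofReal (h x) ∂μ =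
      ∫⁻ x, ENNReal.ofReal (P h x) ∂μ +
        ∫⁻ x, ENNReal.ofReal (h x) * Ωᶜ.indicator (fun _ => 1) x ∂μ := by
    intro h
    rw [← lintegral_add_left (hmeas _).ennreal_ofReal]
    apply lintegral_congr_ae
    filter_upwards [hP h] with x hx
    rw [hx]
    by_cases hx : x ∈ Ω <;> simp [hx]
  refine ⟨{ T := S, T' := S', posT := hSpos, posT' := hSpos', subT := hSsub, subT' := hSsub',
            subintT := ?_, subintT' := ?_, duality := hdual }, ⟨?_, ?_⟩, ?_⟩
  · intro h hh
    rw [hSint h hh, hsplit h]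
    gcongr
    exact D.subintT _ (hPpos h hh)
  · intro k hk
    have h1 := hdual one k (by
      filter_upwards [hone] with x hx
      rw [hx]
      exact zero_le_one) hk
    have h2 : ∫⁻ x, ENNReal.ofReal (S' k x) ∂μ = ∫⁻ x, ENNReal.ofReal (one x * S' k x) ∂μ := by
      apply lintegral_congr_ae
      filter_upwards [hone] with x hx
      rw [hx, one_mul]
    rw [h2, ← h1]
    apply le_of_eq
    apply lintegral_congr_ae
    filter_upwards [hSone] with y hy
    rw [hy, one_mul]
  · intro h hh
    have h1 : h = one := by
      apply Lp.ext
      filter_upwards [hh, hone] with x h1 h2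
      rw [h1, h2]
    rw [h1]
    exact hSone
  · intro h hh hi
    change ∫⁻ y, ENNReal.ofReal (S h y) ∂ν = _
    rw [hSint h hh, hsplit h, hIP (P h) (hPpos h hh)]
    · rw [integrable_congr (hP h)]
      exact hi.indicator hΩ
    · filter_upwards [hP h] with x hx hn
      rw [hx]
      simp [hn]
  · intro h hh
    have h1 : P h = h := by
      apply Lp.ext
      filter_upwards [hP h, hh] with x h1 h2
      rw [h1]
      by_cases hx : x ∈ Ω
      · simp [hx]
      · simp [hx, h2 hx]
    have h2 : R h = 0 := by
      apply Lp.ext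
      filter_upwards [hR h, Lp.coeFn_zero ℝ ⊤ ν] with y h3 h4
      rw [h3, h4, Pi.zero_apply]
      apply integral_eq_zero_of_ae
      filter_upwards [hh] with x hx
      by_cases hxΩ : x ∈ Ω
      · simp [hKΩ x y hxΩ]
      · simp [hx hxΩ]
    change D.T (P h) + R h = D.T h
    rw [h1, h2, add_zero]

end StmtSeven

/-- A doubly substochastic operator `T`, integral-preserving on functions supported in a
measurable set `Ω`, agrees on functions supported in `Ω` with some doubly stochastic
operator if and only if `μ(X∖Ω) = ∫_Y (1 − T(χ_Ω)) dν` (both sides possibly infinite). -/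
theorem stmt7 {X Y : Type*} [MeasurableSpace X] [MeasurableSpace Y]
    (μ : Measure X) (ν : Measure Y) [SigmaFinite μ] [SigmaFinite ν]
    (D : DSSPair μ ν) (Ω : Set X) (hΩ : MeasurableSet Ω)
    (hIP : ∀ h : Lp ℝ ⊤ μ, (∀ᵐ x ∂μ, 0 ≤ h x) → Integrable h μ →
      (∀ᵐ x ∂μ, x ∉ Ω → h x = 0) →
      ∫⁻ y, ENNReal.ofReal ((D.T h) y) ∂ν = ∫⁻ x, ENNReal.ofReal (h x) ∂μ)
    (e : Lp ℝ ⊤ μ) (he : ⇑e =ᵐ[μ] Ω.indicator (fun _ => (1 : ℝ))) :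
    (∃ D' : DSSPair μ ν, D'.IsDS ∧
        ∀ h : Lp ℝ ⊤ μ, (∀ᵐ x ∂μ, x ∉ Ω → h x = 0) → D'.T h = D.T h) ↔
      μ Ωᶜ = ∫⁻ y, ENNReal.ofReal (1 - (D.T e) y) ∂ν := by
  exact ⟨StmtSeven.forward μ ν D Ω hΩ e he, StmtSeven.backward μ ν D Ω hΩ hIP e he⟩
end
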